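/- Let M∈(1,∞) and let φ₁, φ₂ ∈ C²([0,1]^d,ℝ) satisfy (1/M)·Id ≤ Hess φ_i(x) ≤ M·Id for all i∈{1,2} and x∈[0,1]^d, and assume additionally φ₂∈C^{2,1}([0,1]^d,ℝ). Let p_i(x) = 1/|det[Hess φ_i((∇φ_i)^{-1}(x))]| for x∈∇φ_i([0,1]^d), i∈{1,2}, be the densities of (∇φ₁)_#λ and (∇φ₂)_#λ. Then ‖p₁−p₂‖_{L^∞(∇φ₁([0,1]^d) ∩ ∇φ₂([0,1]^d))} ≤ C ‖φ₁−φ₂‖_{C²([0,1]^d)}, where the constant C∈(0,∞) depends only on d, M and ‖φ₂‖_{C^{2,1}([0,1]^d)}. -/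

import Mathlib

open MeasureTheory ProbabilityTheory
open scoped ENNReal Classical

noncomputable section

abbrev E (d : ℕ) := EuclideanSpace ℝ (Fin d)

def cube (d : ℕ) : Set (E d) := {x | ∀ i, x i ∈ Set.Icc (0:ℝ) 1}

def lam (d : ℕ) : Measure (E d) := volume.restrict (cube d)

def KL {d : ℕ} (ν μ : Measure (E d)) : ℝ := ∫ x, Real.log ((ν.rnDeriv μ) x).toReal ∂ν

def JS {d : ℕ} (μ ν : Measure (E d)) : ℝ :=
  (1/2) * (KL ν ((2:ℝ≥0∞)⁻¹ • (μ + ν)) + KL μ ((2:ℝ≥0∞)⁻¹ • (μ + ν)))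

def ganLoss {d : ℕ} (μstar : Measure (E d)) (G : E d → E d) (D : E d → ℝ) : ℝ :=
  (1/2) * ((∫ y, Real.log (D y) ∂μstar) + ∫ z, Real.log (1 - D (G z)) ∂(lam d))

def hessW {d : ℕ} (φ : E d → ℝ) (x : E d) : E d →L[ℝ] E d →L[ℝ] ℝ :=
  fderivWithin ℝ (fun y => fderivWithin ℝ φ (cube d) y) (cube d) x

def gradW {d : ℕ} (φ : E d → ℝ) (x : E d) : E d :=
  (InnerProductSpace.toDual ℝ (E d)).symm (fderivWithin ℝ φ (cube d) x)

def hessMat {d : ℕ} (φ : E d → ℝ) (x : E d) : Matrix (Fin d) (Fin d) ℝ :=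
  fun i j => hessW φ x (EuclideanSpace.single i 1) (EuclideanSpace.single j 1)

def C2norm {d : ℕ} (φ : E d → ℝ) : ℝ :=
  ⨆ k : Fin 3, ⨆ x : cube d, ‖iteratedFDerivWithin ℝ (k : ℕ) φ (cube d) (x : E d)‖

def C21norm {d : ℕ} (φ : E d → ℝ) : ℝ :=
  C2norm φ + ⨆ p : cube d × cube d,
    ‖iteratedFDerivWithin ℝ 2 φ (cube d) (p.1 : E d) - iteratedFDerivWithin ℝ 2 φ (cube d) (p.2 : E d)‖
      / ‖(p.1 : E d) - (p.2 : E d)‖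

def Pen {d : ℕ} (κ : ℝ) (φ : E d → ℝ) : ℝ :=
  ∫ u, max 0 (φ ((2:ℝ)⁻¹ • (u.1 + u.2)) - (φ u.1 + φ u.2)/2 + (κ/8) * ‖u.1 - u.2‖^2)
    ∂((volume.restrict (cube d)).prod (volume.restrict (cube d)))

lemma cube_convex (d : ℕ) : Convex ℝ (cube d) := by
  intro x hx y hy a b ha hb hab i
  have := (convex_Icc (0:ℝ) 1) (hx i) (hy i) ha hb hab
  simpa using this

lemma cube_compact (d : ℕ) : IsCompact (cube d) := by
  have h : IsCompact (Set.univ.pi fun _ : Fin d => Set.Icc (0:ℝ) 1) :=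
    isCompact_univ_pi fun _ => isCompact_Icc
  have h2 := (PiLp.homeomorph 2 (fun _ : Fin d => ℝ)).isCompact_preimage.2 h
  convert h2 using 1
  ext x
  simp only [cube, Set.mem_preimage, Set.mem_pi, Set.mem_univ, true_imp_iff, Set.mem_setOf_eq]
  rfl

lemma cube_interior (d : ℕ) : (interior (cube d)).Nonempty := by
  refine ⟨WithLp.toLp 2 (fun _ => (1/2:ℝ)), ?_⟩
  rw [mem_interior]
  refine ⟨⋂ i : Fin d, {x : E d | x i ∈ Set.Ioo (0:ℝ) 1}, ?_, ?_, ?_⟩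
  · intro x hx i
    exact Set.Ioo_subset_Icc_self (Set.mem_iInter.1 hx i)
  · refine isOpen_iInter_of_finite fun i => ?_
    exact isOpen_Ioo.preimage (by fun_prop : Continuous fun x : E d => x i)
  · simp only [Set.mem_iInter, Set.mem_setOf_eq]
    intro i
    norm_num

lemma cube_uniqueDiff (d : ℕ) : UniqueDiffOn ℝ (cube d) :=
  uniqueDiffOn_convex (cube_convex d) (cube_interior d)

lemma le_C2norm {d : ℕ} {φ : E d → ℝ} (h : ContDiffOn ℝ 2 φ (cube d)) (k : Fin 3)
    {x : E d} (hx : x ∈ cube d) :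
    ‖iteratedFDerivWithin ℝ (k : ℕ) φ (cube d) x‖ ≤ C2norm φ := by
  have hk : ((k : ℕ) : WithTop ℕ∞) ≤ 2 := by
    have : (k : ℕ) ≤ 2 := by omega
    exact_mod_cast this
  have hc := (h.continuousOn_iteratedFDerivWithin hk (cube_uniqueDiff d)).norm
  have hb := (cube_compact d).bddAbove_image hc
  have hb' : BddAbove (Set.range fun x : cube d =>
      ‖iteratedFDerivWithin ℝ (k : ℕ) φ (cube d) (x : E d)‖) := by
    rwa [Set.image_eq_range] at hb
  have h1 := le_ciSup hb' ⟨x, hx⟩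
  refine h1.trans ?_
  exact le_ciSup (f := fun k : Fin 3 => ⨆ x : cube d,
    ‖iteratedFDerivWithin ℝ (k : ℕ) φ (cube d) (x : E d)‖) (Set.finite_range _).bddAbove k

/-- compact convex set of matrices -/
def goodS (d : ℕ) (M : ℝ) : Set (Fin d → Fin d → ℝ) :=
  {A | (∀ i j, |A i j| ≤ M) ∧
    ∀ v : Fin d → ℝ, (1/M) * ∑ i, v i ^ 2 ≤ ∑ i, ∑ j, v i * v j * A i j}

lemma goodS_convex (d : ℕ) (M : ℝ) : Convex ℝ (goodS d M) := by
  intro A hA B hB a b ha hb hab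
  refine ⟨fun i j => ?_, fun v => ?_⟩
  · have h1 := abs_le.1 (hA.1 i j)
    have h2 := abs_le.1 (hB.1 i j)
    have := (convex_Icc (-M) M) h1 h2 ha hb hab
    exact abs_le.2 (by simpa using this)
  · have h1 := mul_le_mul_of_nonneg_left (hA.2 v) ha
    have h2 := mul_le_mul_of_nonneg_left (hB.2 v) hb
    have e : ∑ i, ∑ j, v i * v j * (a • A + b • B) i j
        = a * (∑ i, ∑ j, v i * v j * A i j) + b * (∑ i, ∑ j, v i * v j * B i j) := by
      simp only [Finset.mul_sum, ← Finset.sum_add_distrib]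
      refine Finset.sum_congr rfl fun i _ => Finset.sum_congr rfl fun j _ => ?_
      simp
      ring
    rw [e]
    calc (1/M) * ∑ i, v i ^ 2 = (a + b) * ((1/M) * ∑ i, v i ^ 2) := by rw [hab, one_mul]
      _ ≤ _ := by linarith

lemma goodS_compact (d : ℕ) (M : ℝ) : IsCompact (goodS d M) := by
  have h : IsCompact (Set.univ.pi fun _ : Fin d => Set.univ.pi fun _ : Fin d => Set.Icc (-M) M) :=
    isCompact_univ_pi fun _ => isCompact_univ_pi fun _ => isCompact_Icc
  refine h.of_isClosed_subset ?_ ?_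
  · have : goodS d M = (⋂ i, ⋂ j, {A : Fin d → Fin d → ℝ | |A i j| ≤ M}) ∩
        ⋂ v : Fin d → ℝ, {A : Fin d → Fin d → ℝ |
          (1/M) * ∑ i, v i ^ 2 ≤ ∑ i, ∑ j, v i * v j * A i j} := by
      ext A
      simp [goodS]
    rw [this]
    refine IsClosed.inter ?_ ?_
    · exact isClosed_iInter fun i => isClosed_iInter fun j =>
        isClosed_le (by fun_prop) (by fun_prop)
    · exact isClosed_iInter fun v => isClosed_le (by fun_prop) (by fun_prop)
  · intro A hA i _ j _
    exact abs_le.1 (hA.1 i j)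

lemma goodS_det {d : ℕ} {M : ℝ} (hM : 1 < M) {A : Fin d → Fin d → ℝ} (hA : A ∈ goodS d M) :
    (Matrix.of A).det ≠ 0 := by
  intro h0
  obtain ⟨v, hv, hv0⟩ := Matrix.exists_mulVec_eq_zero_iff.2 h0
  have h := hA.2 v
  have e : ∑ i, ∑ j, v i * v j * A i j = 0 := by
    refine Finset.sum_eq_zero fun i _ => ?_
    have := congrFun hv0 i
    simp only [Matrix.mulVec, dotProduct, Matrix.of_apply, Pi.zero_apply] at this
    calc ∑ j, v i * v j * A i j = v i * ∑ j, A i j * v j := by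
          rw [Finset.mul_sum]; exact Finset.sum_congr rfl fun j _ => by ring
      _ = 0 := by rw [this, mul_zero]
  rw [e] at h
  have hpos : 0 < ∑ i, v i ^ 2 := by
    obtain ⟨i, hi⟩ := Function.ne_iff.1 hv
    exact Finset.sum_pos' (fun _ _ => sq_nonneg _) ⟨i, Finset.mem_univ _, by
      have : v i ≠ 0 := hi
      positivity⟩
  have : 0 < (1/M) * ∑ i, v i ^ 2 := by positivity
  linarith

lemma invdet_lip (d : ℕ) (M : ℝ) (hM : 1 < M) :
    ∃ L, LipschitzOnWith L (fun A : Fin d → Fin d → ℝ => 1 / |(Matrix.of A).det|) (goodS d M) := by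
  have hdet : ContDiff ℝ 1 (fun A : Fin d → Fin d → ℝ => (Matrix.of A).det) := by
    simp only [Matrix.det_apply', Matrix.of_apply]
    refine ContDiff.sum fun σ _ => contDiff_const.mul (contDiff_prod fun i _ => ?_)
    fun_prop
  refine ContDiffOn.exists_lipschitzOnWith (n := 1) ?_ one_ne_zero
    (goodS_convex d M) (goodS_compact d M)
  intro A hA
  have h0 := goodS_det hM hA
  refine ContDiffAt.contDiffWithinAt ?_
  exact contDiffAt_const.div (hdet.contDiffAt.abs h0) (abs_ne_zero.2 h0)

lemma hess_symm {d : ℕ} {φ : E d → ℝ} (h : ContDiffOn ℝ 2 φ (cube d)) {x : E d}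
    (hx : x ∈ cube d) (v w : E d) : hessW φ x v w = hessW φ x w v := by
  have h1 : IsSymmSndFDerivWithinAt ℝ φ (cube d) x := by
    refine (h x hx).isSymmSndFDerivWithinAt (by simp) (cube_uniqueDiff d) ?_ hx
    rw [(cube_convex d).closure_interior_eq_closure_of_nonempty_interior (cube_interior d)]
    exact subset_closure hx
  exact h1 v w

lemma hessMat_good {d : ℕ} {M : ℝ} (hM : 1 < M) {φ : E d → ℝ} (h : ContDiffOn ℝ 2 φ (cube d))
    {x : E d} (hx : x ∈ cube d)
    (hb : ∀ v : E d, (1/M) * ‖v‖^2 ≤ hessW φ x v v ∧ hessW φ x v v ≤ M * ‖v‖^2) :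
    hessMat φ x ∈ goodS d M := by
  have hM0 : 0 < 1 / M := by positivity
  refine ⟨fun i j => ?_, fun v => ?_⟩
  · set a : E d := EuclideanSpace.single i 1
    set b : E d := EuclideanSpace.single j 1
    have ha : ‖a‖ = 1 := by simp [a]
    have hbb : ‖b‖ = 1 := by simp [b]
    have hp := hb (a + b)
    have hm := hb (a - b)
    have hs := hess_symm h hx a b
    have par := parallelogram_law_with_norm ℝ a b
    rw [ha, hbb] at par
    simp only [map_add, map_sub, ContinuousLinearMap.add_apply, ContinuousLinearMap.sub_apply]
      at hp hm
    have q1 := mul_nonneg hM0.le (sq_nonneg ‖a + b‖)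
    have q2 := mul_nonneg hM0.le (sq_nonneg ‖a - b‖)
    have r1 : ‖a + b‖^2 ≤ 4 := by nlinarith [norm_nonneg (a - b)]
    have r2 : ‖a - b‖^2 ≤ 4 := by nlinarith [norm_nonneg (a + b)]
    have s1 : M * ‖a + b‖^2 ≤ M * 4 := mul_le_mul_of_nonneg_left r1 (by linarith)
    have s2 : M * ‖a - b‖^2 ≤ M * 4 := mul_le_mul_of_nonneg_left r2 (by linarith)
    change |hessW φ x a b| ≤ M
    rw [abs_le]
    constructor <;> linarith
  · set V : E d := WithLp.toLp 2 v
    have hV : V = ∑ i, v i • (EuclideanSpace.single i (1:ℝ) : E d) := by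
      ext k
      simp [V, Pi.single_apply]
    have hn : ‖V‖^2 = ∑ i, v i ^ 2 := by
      rw [EuclideanSpace.norm_sq_eq]
      simp [V]
    have key := (hb V).1
    rw [hn] at key
    refine key.trans (le_of_eq ?_)
    rw [hV]
    simp only [map_sum, map_smul, ContinuousLinearMap.sum_apply, ContinuousLinearMap.smul_apply,
      smul_eq_mul, Finset.mul_sum, hessMat]
    rw [Finset.sum_comm]
    exact Finset.sum_congr rfl fun i _ => Finset.sum_congr rfl fun j _ => by ring

lemma grad_mono {d : ℕ} {M : ℝ} {φ : E d → ℝ} (h : ContDiffOn ℝ 2 φ (cube d))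
    (hb : ∀ x ∈ cube d, ∀ v : E d, (1/M) * ‖v‖^2 ≤ hessW φ x v v)
    {a b : E d} (ha : a ∈ cube d) (hbc : b ∈ cube d) :
    (1/M) * ‖a - b‖^2 ≤ fderivWithin ℝ φ (cube d) a (a - b) - fderivWithin ℝ φ (cube d) b (a - b) := by
  set u := a - b with hu
  set f : ℝ → ℝ := fun t => fderivWithin ℝ φ (cube d) (b + t • u) u with hf
  have hmem : ∀ t ∈ Set.Icc (0:ℝ) 1, b + t • u ∈ cube d := fun t ht =>
    (cube_convex d).add_smul_sub_mem hbc ha ht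
  have hD : DifferentiableOn ℝ (fun y => fderivWithin ℝ φ (cube d) y) (cube d) :=
    (h.fderivWithin (m := 1) (cube_uniqueDiff d) (by norm_num)).differentiableOn (by simp)
  have hder : ∀ t ∈ Set.Icc (0:ℝ) 1,
      HasDerivWithinAt f (hessW φ (b + t • u) u u) (Set.Icc 0 1) t := by
    intro t ht
    have h1 : HasFDerivWithinAt (fun y => fderivWithin ℝ φ (cube d) y) (hessW φ (b + t • u))
      (cube d) (b + t • u) := (hD _ (hmem t ht)).hasFDerivWithinAt
    have h2 : HasDerivWithinAt (fun t : ℝ => b + t • u) u (Set.Icc 0 1) t := by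
      have := ((hasDerivAt_id t).smul_const u).const_add b
      simpa using this.hasDerivWithinAt
    have h3 := h1.comp_hasDerivWithinAt t h2 hmem
    have h4 := h3.clm_apply (hasDerivWithinAt_const t (Set.Icc (0:ℝ) 1) u)
    simpa using h4
  have hi : ∀ t ∈ interior (Set.Icc (0:ℝ) 1), HasDerivAt f (hessW φ (b + t • u) u u) t := by
    intro t ht
    exact (hder t (interior_subset ht)).hasDerivAt (mem_interior_iff_mem_nhds.1 ht)
  have := (convex_Icc (0:ℝ) 1).mul_sub_le_image_sub_of_le_deriv (f := f) (C := (1/M) * ‖u‖^2)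
    (fun t ht => (hder t ht).continuousWithinAt)
    (fun t ht => (hi t ht).differentiableAt.differentiableWithinAt)
    (fun t ht => by rw [(hi t ht).deriv]; exact hb _ (hmem t (interior_subset ht)) u)
    0 (by simp) 1 (by simp) zero_le_one
  simpa [hf, hu] using this

lemma sub_fderivs {d : ℕ} {φ₁ φ₂ : E d → ℝ} (h1 : ContDiffOn ℝ 2 φ₁ (cube d))
    (h2 : ContDiffOn ℝ 2 φ₂ (cube d)) {a : E d} (ha : a ∈ cube d) :
    ‖fderivWithin ℝ φ₁ (cube d) a - fderivWithin ℝ φ₂ (cube d) a‖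
      ≤ C2norm (fun y => φ₁ y - φ₂ y) ∧
    ‖iteratedFDerivWithin ℝ 2 φ₁ (cube d) a - iteratedFDerivWithin ℝ 2 φ₂ (cube d) a‖
      ≤ C2norm (fun y => φ₁ y - φ₂ y) := by
  have hs : ContDiffOn ℝ 2 (fun y => φ₁ y - φ₂ y) (cube d) := h1.sub h2
  have hu := cube_uniqueDiff d
  constructor
  · have := le_C2norm hs 1 ha
    rw [show (((1 : Fin 3) : ℕ)) = 1 from rfl, norm_iteratedFDerivWithin_one _ (hu a ha)] at this
    have e := fderivWithin_sub (hu a ha) ((h1.differentiableOn (by simp)) a ha)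
      ((h2.differentiableOn (by simp)) a ha)
    rw [← e]
    exact this
  · have := le_C2norm hs 2 ha
    have e := iteratedFDerivWithin_sub_apply (h1 a ha) (h2 a ha) hu ha (i := 2)
    rw [← e]
    exact this

/-- Lipschitz dependence of the pushforward density on the potential.
The constant `C` depends only on `d`, `M` and (a bound `K` on) `‖φ₂‖_{C^{2,1}}`. -/
theorem stmt5 (d : ℕ) (M K : ℝ) (hM : 1 < M) (hK : 0 ≤ K) :
    ∃ C : ℝ, 0 < C ∧
      ∀ φ₁ φ₂ : E d → ℝ,
        ContDiffOn ℝ 2 φ₁ (cube d) → ContDiffOn ℝ 2 φ₂ (cube d) →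
        (∀ x ∈ cube d, ∀ v : E d,
          (1/M) * ‖v‖^2 ≤ hessW φ₁ x v v ∧ hessW φ₁ x v v ≤ M * ‖v‖^2) →
        (∀ x ∈ cube d, ∀ v : E d,
          (1/M) * ‖v‖^2 ≤ hessW φ₂ x v v ∧ hessW φ₂ x v v ≤ M * ‖v‖^2) →
        -- `φ₂ ∈ C^{2,1}` with `‖φ₂‖_{C^{2,1}} ≤ K`
        LipschitzOnWith (Real.toNNReal K)
          (fun x => iteratedFDerivWithin ℝ 2 φ₂ (cube d) x) (cube d) →
        C2norm φ₂ ≤ K →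
        ∀ p₁ p₂ : E d → ℝ,
        (∀ x, p₁ x = 1 / |(hessMat φ₁ (Function.invFunOn (gradW φ₁) (cube d) x)).det|) →
        (∀ x, p₂ x = 1 / |(hessMat φ₂ (Function.invFunOn (gradW φ₂) (cube d) x)).det|) →
        ∀ x ∈ (gradW φ₁ '' cube d) ∩ (gradW φ₂ '' cube d),
          |p₁ x - p₂ x| ≤ C * C2norm (fun y => φ₁ y - φ₂ y) := by
  obtain ⟨L, hL⟩ := invdet_lip d M hM
  have hM0 : 0 < M := by linarith
  refine ⟨(L:ℝ) * (1 + K * M) + 1, by positivity, ?_⟩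
  intro φ₁ φ₂ h1 h2 hb1 hb2 hlip _ p₁ p₂ hp1 hp2 x hx
  set ε := C2norm (fun y => φ₁ y - φ₂ y) with hε
  have ha := Function.invFunOn_mem hx.1
  have hae := Function.invFunOn_eq hx.1
  have hb := Function.invFunOn_mem hx.2
  have hbe := Function.invFunOn_eq hx.2
  rw [hp1, hp2]
  set a := Function.invFunOn (gradW φ₁) (cube d) x
  set b := Function.invFunOn (gradW φ₂) (cube d) x
  obtain ⟨hd1, hd2⟩ := sub_fderivs h1 h2 ha
  have hε0 : 0 ≤ ε := (norm_nonneg _).trans hd1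
  have hgrad : fderivWithin ℝ φ₁ (cube d) a = fderivWithin ℝ φ₂ (cube d) b :=
    (InnerProductSpace.toDual ℝ (E d)).symm.injective (hae.trans hbe.symm)
  have hab : ‖a - b‖ ≤ M * ε := by
    have hm := grad_mono (M := M) h2 (fun x hx v => (hb2 x hx v).1) ha hb
    rw [← hgrad] at hm
    have h3 : (1/M) * ‖a - b‖^2 ≤ ε * ‖a - b‖ := by
      refine hm.trans ?_
      have h4 := ContinuousLinearMap.le_opNorm
        (fderivWithin ℝ φ₁ (cube d) a - fderivWithin ℝ φ₂ (cube d) a) (a - b)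
      rw [ContinuousLinearMap.sub_apply, Real.norm_eq_abs, abs_sub_comm] at h4
      exact (le_abs_self _).trans (h4.trans (mul_le_mul_of_nonneg_right hd1 (norm_nonneg _)))
    rcases eq_or_lt_of_le (norm_nonneg (a - b)) with h0 | h0
    · rw [← h0]; positivity
    · have h5 : ‖a - b‖^2 ≤ M * (ε * ‖a - b‖) := by
        have := mul_le_mul_of_nonneg_left h3 hM0.le
        rwa [← mul_assoc, mul_one_div_cancel hM0.ne', one_mul] at this
      nlinarith
  have hiter : ‖iteratedFDerivWithin ℝ 2 φ₁ (cube d) a - iteratedFDerivWithin ℝ 2 φ₂ (cube d) b‖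
      ≤ (1 + K * M) * ε := by
    have h6 := hlip.norm_sub_le ha hb
    rw [Real.coe_toNNReal _ hK] at h6
    have h7 := norm_sub_le_norm_sub_add_norm_sub (iteratedFDerivWithin ℝ 2 φ₁ (cube d) a)
      (iteratedFDerivWithin ℝ 2 φ₂ (cube d) a) (iteratedFDerivWithin ℝ 2 φ₂ (cube d) b)
    have h8 := mul_le_mul_of_nonneg_left hab hK
    linarith
  have hmat : ‖(fun i j => hessMat φ₁ a i j - hessMat φ₂ b i j : Fin d → Fin d → ℝ)‖
      ≤ (1 + K * M) * ε := by
    have hnn : 0 ≤ (1 + K * M) * ε := by positivity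
    refine (pi_norm_le_iff_of_nonneg hnn).2 fun i => (pi_norm_le_iff_of_nonneg hnn).2 fun j => ?_
    have h9 := ContinuousMultilinearMap.le_opNorm
      (iteratedFDerivWithin ℝ 2 φ₁ (cube d) a - iteratedFDerivWithin ℝ 2 φ₂ (cube d) b)
      ![EuclideanSpace.single i 1, EuclideanSpace.single j 1]
    rw [ContinuousMultilinearMap.sub_apply,
      iteratedFDerivWithin_two_apply' _ (cube_uniqueDiff d) ha,
      iteratedFDerivWithin_two_apply' _ (cube_uniqueDiff d) hb] at h9
    refine (h9.trans (le_of_eq ?_)).trans hiter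
    simp [Fin.prod_univ_two]
  have hfin := hL.norm_sub_le (hessMat_good hM h1 ha (hb1 a ha)) (hessMat_good hM h2 hb (hb2 b hb))
  have h11 := le_trans hfin (mul_le_mul_of_nonneg_left hmat L.2)
  refine le_trans h11 ?_
  have h12 : (L : ℝ) * ((1 + K * M) * ε) ≤ ((L : ℝ) * (1 + K * M) + 1) * ε := by nlinarith
  exact h12

end
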